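/- If m ∈ G(I^k), s ∈ set(m), and x_s·m/x_{min(m)} ≺ v^k, then s > min(m̃), where m̃ is the part of m supported in x_{l+1},…,x_n. -/

import Mathlib

open MvPolynomial Finset

/-- A monomial in `n` variables, recorded by its exponent vector
(index `i : Fin n` corresponds to the variable `x_{i+1}` of the paper). -/
abbrev Mon (n : ℕ) := Fin n →₀ ℕ

/-- The exponent vector of the single variable `x_{j+1}` (`0`-indexed `j`). -/
noncomputable def sing (n j : ℕ) : Mon n :=
  Finsupp.onFinset Finset.univ (fun i => if (i : ℕ) = j then 1 else 0)
    (fun a _ => Finset.mem_univ a)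

/-- Total degree of a monomial. -/
def deg {n : ℕ} (m : Mon n) : ℕ := m.sum fun _ e => e

/-- `m₁ <_lex m₂` for the lexicographic order with `x_1 > x_2 > ⋯ > x_n`. -/
def lexLT {n : ℕ} (m₁ m₂ : Mon n) : Prop :=
  ∃ i : Fin n, (∀ j : Fin n, j < i → m₁ j = m₂ j) ∧ m₁ i < m₂ i

def lexLE {n : ℕ} (m₁ m₂ : Mon n) : Prop := m₁ = m₂ ∨ lexLT m₁ m₂

/-- `m₁ <_revlex m₂` : the increasing reverse lexicographic order. -/
def revLT {n : ℕ} (m₁ m₂ : Mon n) : Prop :=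
  ∃ s : Fin n, (∀ i : Fin n, s < i → m₁ i = m₂ i) ∧ m₂ s < m₁ s

def revLE {n : ℕ} (m₁ m₂ : Mon n) : Prop := m₁ = m₂ ∨ revLT m₁ m₂

/-- `min(m)`: the (0-indexed) smallest index in the support of `m`. -/
noncomputable def minIdx {n : ℕ} (m : Mon n) : ℕ := sInf {j : ℕ | ∃ h : j < n, m ⟨j, h⟩ ≠ 0}

/-- `m̄`: the part of `m` supported in the variables `x_1, …, x_l`
(0-indexed: indices `< l`). -/
noncomputable def lowPart {n : ℕ} (l : ℕ) (m : Mon n) : Mon n :=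
  m.filter fun i => (i : ℕ) < l

/-- `m̃`: the part of `m` supported in the variables `x_{l+1}, …, x_n`
(0-indexed: indices `≥ l`). -/
noncomputable def highPart {n : ℕ} (l : ℕ) (m : Mon n) : Mon n :=
  m.filter fun i => l ≤ (i : ℕ)

/-- The exponent vector of `u = x_1 · x_{l+1}^{a_{l+1}} ⋯ x_n^{a_n}`, where
`a j` (for `l ≤ j < n`, 0-indexed) is the exponent of `x_{j+1}`. -/
noncomputable def uVec (n l : ℕ) (a : ℕ → ℕ) : Mon n :=
  sing n 0 + ∑ j ∈ Finset.Ico l n, a j • sing n j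

/-- The exponent vector of `v = x_l · x_n^{d-1}`. -/
noncomputable def vVec (n l d : ℕ) : Mon n :=
  sing n (l - 1) + (d - 1) • sing n (n - 1)

/-- The lexsegment `L(u,v)`: monomials `w` of degree `d` with `u ≥_lex w ≥_lex v`. -/
def lexSeg (n l d : ℕ) (a : ℕ → ℕ) : Set (Mon n) :=
  { w | deg w = d ∧ lexLE (vVec n l d) w ∧ lexLE w (uVec n l a) }

/-- The lexsegment ideal `I = (L(u,v)) ⊆ K[x_1,…,x_n]`. -/
noncomputable def lexIdeal (n l d : ℕ) (a : ℕ → ℕ) (K : Type*) [Field K] :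
    Ideal (MvPolynomial (Fin n) K) :=
  Ideal.span ((fun w => monomial w (1 : K)) '' lexSeg n l d a)

/-- `G(J)`: the minimal monomial generators of a monomial ideal `J`, i.e.
monomials `m ∈ J` with `m / x_i ∉ J` for every `i ∈ supp m`. -/
def minGens {n : ℕ} (K : Type*) [Field K] (J : Ideal (MvPolynomial (Fin n) K)) :
    Set (Mon n) :=
  { m | monomial m (1 : K) ∈ J ∧
      ∀ i ∈ m.support, monomial (m - Finsupp.single i 1) (1 : K) ∉ J }

/-- `J_{<revlex m}`: the ideal generated by all `z ∈ G(J)` with `z <_revlex m`. -/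
noncomputable def idealBelow {n : ℕ} (K : Type*) [Field K]
    (J : Ideal (MvPolynomial (Fin n) K)) (m : Mon n) : Ideal (MvPolynomial (Fin n) K) :=
  Ideal.span ((fun z => monomial z (1 : K)) '' { z | z ∈ minGens K J ∧ revLT z m })

/-- `set(m) = {j : x_j · m ∈ J_{<revlex m}}` (0-indexed). -/
def setOfGen {n : ℕ} (K : Type*) [Field K] (J : Ideal (MvPolynomial (Fin n) K))
    (m : Mon n) : Set ℕ :=
  { j | j < n ∧ monomial (m + sing n j) (1 : K) ∈ idealBelow K J m }

/-- The order `≺` on monomials: compare first the degree of the part supported in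
`x_1,…,x_l`, then `<_lex`. -/
def precLT {n : ℕ} (l : ℕ) (m₁ m₂ : Mon n) : Prop :=
  deg (lowPart l m₁) < deg (lowPart l m₂) ∨
    (deg (lowPart l m₁) = deg (lowPart l m₂) ∧ lexLT m₁ m₂)

/-- `w = g(z)`: `w` is the `<_revlex`-smallest minimal monomial generator of `J`
dividing the monomial `z` (the value of the decomposition function). -/
def isDecompOf {n : ℕ} (K : Type*) [Field K] (J : Ideal (MvPolynomial (Fin n) K))
    (z w : Mon n) : Prop :=
  w ∈ minGens K J ∧ w ≤ z ∧ ∀ w' ∈ minGens K J, w' ≤ z → revLE w w'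

lemma hp_deg {n : ℕ} (m : Mon n) : deg m = ∑ i, m i := by
  unfold deg; exact Finsupp.sum_fintype _ _ (fun _ => rfl)

lemma hp_low {n : ℕ} (l : ℕ) (m : Mon n) :
    deg (lowPart l m) = ∑ i : Fin n, if (i : ℕ) < l then m i else 0 := by
  rw [hp_deg]
  exact Finset.sum_congr rfl fun i _ => by simp [lowPart, Finsupp.filter_apply]

lemma hp_deg_add {n : ℕ} (m p : Mon n) : deg (m + p) = deg m + deg p := by
  simp [hp_deg, Finset.sum_add_distrib]

lemma hp_low_add {n : ℕ} (l : ℕ) (m p : Mon n) :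
    deg (lowPart l (m + p)) = deg (lowPart l m) + deg (lowPart l p) := by
  rw [hp_low, hp_low, hp_low, ← Finset.sum_add_distrib]
  exact Finset.sum_congr rfl fun i _ => by split_ifs <;> simp

lemma hp_sing {n : ℕ} (i : Fin n) : sing n i = Finsupp.single i 1 := by
  ext j
  simp [sing, Finsupp.single_apply, Fin.ext_iff, eq_comm]

lemma hp_deg_single {n : ℕ} (i : Fin n) : deg (Finsupp.single i 1 : Mon n) = 1 := by
  simp [deg]

lemma hp_low_single {n : ℕ} (l : ℕ) (i : Fin n) :
    deg (lowPart l (Finsupp.single i 1 : Mon n)) = if (i : ℕ) < l then 1 else 0 := by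
  rw [hp_low, Finset.sum_eq_single i]
  · simp
  · intro j _ hj; simp [Finsupp.single_apply, hj.symm]
  · simp

lemma hp_low_pos {n : ℕ} (l : ℕ) (m : Mon n) (i : Fin n) (hi : (i : ℕ) < l) :
    m i ≤ deg (lowPart l m) := by
  rw [hp_low]
  have := Finset.single_le_sum (f := fun i : Fin n => if (i : ℕ) < l then m i else 0)
    (fun _ _ => Nat.zero_le _) (Finset.mem_univ i)
  simpa [hi] using this

lemma hp_v {n l d : ℕ} (i : Fin n) : vVec n l d i =
    (if (i : ℕ) = l - 1 then 1 else 0) + (d - 1) * (if (i : ℕ) = n - 1 then 1 else 0) := by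
  simp [vVec, sing]

lemma hp_seg {n l d : ℕ} {a : ℕ → ℕ} (hl2 : 2 ≤ l) (hln : l ≤ n - 1) {w : Mon n}
    (hw : w ∈ lexSeg n l d a) : deg w = d ∧ 1 ≤ deg (lowPart l w) := by
  refine ⟨hw.1, ?_⟩
  have hn : l - 1 < n := by omega
  have hv : 1 ≤ vVec n l d ⟨l - 1, hn⟩ := by simp [hp_v]
  rcases hw.2.1 with h | ⟨i, h1, h2⟩
  · subst h
    exact hv.trans (hp_low_pos l _ _ (by simp; omega))
  · rcases lt_or_ge (i : ℕ) l with hi | hi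
    · exact le_trans (by omega) (hp_low_pos l w i hi)
    · rw [h1 ⟨l - 1, hn⟩ (by simp [Fin.lt_def]; omega)] at hv
      exact hv.trans (hp_low_pos l _ _ (by simp; omega))

lemma hp_pow {n l d : ℕ} {a : ℕ → ℕ} (K : Type*) [Field K] (hl2 : 2 ≤ l) (hln : l ≤ n - 1)
    (k : ℕ) : ∃ P : Set (Mon n),
      (lexIdeal n l d a K) ^ k = Ideal.span ((fun w => monomial w (1 : K)) '' P) ∧
      ∀ p ∈ P, deg p = k * d ∧ k ≤ deg (lowPart l p) := by
  induction k with
  | zero =>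
    refine ⟨{0}, ?_, ?_⟩
    · have : (monomial (0 : Mon n) (1 : K)) = 1 := rfl
      simp [this]
    · simp [hp_deg]
  | succ k ih =>
    obtain ⟨P, h1, h2⟩ := ih
    refine ⟨Set.image2 (· + ·) P (lexSeg n l d a), ?_, ?_⟩
    · rw [pow_succ, h1, lexIdeal, Ideal.span_mul_span']
      congr 1
      ext x
      simp only [Set.mem_mul, Set.mem_image, Set.mem_image2]
      constructor
      · rintro ⟨_, ⟨p, hp, rfl⟩, _, ⟨w, hw, rfl⟩, rfl⟩
        exact ⟨p + w, ⟨p, hp, w, hw, rfl⟩, by simp [monomial_mul]⟩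
      · rintro ⟨_, ⟨p, hp, w, hw, rfl⟩, rfl⟩
        exact ⟨_, ⟨p, hp, rfl⟩, _, ⟨w, hw, rfl⟩, by simp [monomial_mul]⟩
    · rintro _ ⟨p, hp, w, hw, rfl⟩
      have := h2 p hp
      have := hp_seg hl2 hln hw
      simp only [hp_deg_add, hp_low_add]
      constructor
      · rw [add_mul]; omega
      · omega

lemma hp_mem {n : ℕ} (K : Type*) [Field K] (P : Set (Mon n)) (m : Mon n) :
    monomial m (1 : K) ∈ Ideal.span ((fun w => monomial w (1 : K)) '' P) ↔ ∃ p ∈ P, p ≤ m := by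
  classical
  rw [mem_ideal_span_monomial_image]
  simp [support_monomial]

lemma hp_min {n l d : ℕ} {a : ℕ → ℕ} (K : Type*) [Field K] (hl2 : 2 ≤ l) (hln : l ≤ n - 1)
    (k : ℕ) {m : Mon n} (hm : m ∈ minGens K ((lexIdeal n l d a K) ^ k)) :
    deg m = k * d ∧ k ≤ deg (lowPart l m) := by
  obtain ⟨P, h1, h2⟩ := hp_pow (d := d) (a := a) K hl2 hln k
  rw [h1] at hm
  obtain ⟨hm1, hm2⟩ := hm
  obtain ⟨p, hp, hpm⟩ := (hp_mem K P m).1 hm1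
  suffices p = m by subst this; exact h2 p hp
  by_contra hne
  have : ∃ i, p i < m i := by
    by_contra! hc
    exact hne (le_antisymm hpm hc)
  obtain ⟨i, hi⟩ := this
  refine hm2 i (by simp; omega) ((hp_mem K P _).2 ⟨p, hp, fun j => ?_⟩)
  have := hpm j
  by_cases hij : i = j
  · subst hij; simp; omega
  · simpa [Finsupp.single_apply, hij] using this

lemma hp_low_v {n l d : ℕ} (hl2 : 2 ≤ l) (hln : l ≤ n - 1) (k : ℕ) :
    deg (lowPart l (k • vVec n l d)) = k := by
  rw [hp_low, Finset.sum_eq_single (⟨l - 1, by omega⟩ : Fin n)]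
  · have : l - 1 ≠ n - 1 := by omega
    simp [hp_v, this]; omega
  · intro j _ hj
    have h1 : (j : ℕ) ≠ l - 1 := fun h => hj (Fin.ext h)
    split_ifs with h
    · have : (j : ℕ) ≠ n - 1 := by omega
      simp [hp_v, h1, this]
    · rfl
  · simp

lemma hp_deg_v {n l d : ℕ} (hd : 2 ≤ d) (hl2 : 2 ≤ l) (hln : l ≤ n - 1) (k : ℕ) :
    deg (k • vVec n l d) = k * d := by
  have h1 : l - 1 < n := by omega
  have h2 : n - 1 < n := by omega
  have e1 := hp_sing (⟨l - 1, h1⟩ : Fin n)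
  have e2 := hp_sing (⟨n - 1, h2⟩ : Fin n)
  have hv : deg (vVec n l d) = d := by
    simp only at e1 e2
    rw [vVec, hp_deg_add, e1, e2, hp_deg_single]
    have e3 : deg (Finsupp.single (⟨n - 1, h2⟩ : Fin n) (d - 1) : Mon n) = d - 1 :=
      Finsupp.sum_single_index rfl
    rw [Finsupp.smul_single, smul_eq_mul, mul_one, e3]; omega
  rw [hp_deg] at hv ⊢
  simp [← Finset.mul_sum, hv]

lemma hp_prec {n l d : ℕ} (hd : 2 ≤ d) (hl2 : 2 ≤ l) (hln : l ≤ n - 1) (k : ℕ) {w : Mon n}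
    (hw : deg w = k * d) (hp : precLT l w (k • vVec n l d)) : deg (lowPart l w) < k := by
  rcases hp with h | ⟨h, i, h1, h2⟩
  · rwa [hp_low_v hl2 hln] at h
  exfalso
  -- a later strict drop is compensated nowhere
  have hv0 : ∀ j : Fin n, (j : ℕ) ≠ l - 1 → (j : ℕ) ≠ n - 1 → (k • vVec n l d) j = 0 := by
    intro j h1 h2; simp [hp_v, h1, h2]
  by_cases hi : (i : ℕ) = l - 1
  · refine (ne_of_lt ?_) h
    rw [hp_low, hp_low]
    refine Finset.sum_lt_sum (fun j _ => ?_) ⟨i, Finset.mem_univ _, ?_⟩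
    · split_ifs with hj
      · rcases lt_or_ge j i with hji | hji
        · exact (h1 j hji).le
        · have : j = i := Fin.ext (by rw [Fin.le_def] at hji; omega)
          subst this; exact h2.le
      · rfl
    · have : (i : ℕ) < l := by omega
      simpa only [this, if_true] using h2
  · by_cases hi' : (i : ℕ) = n - 1
    · have hdeg := hp_deg_v hd hl2 hln k
      rw [← hw] at hdeg
      refine (ne_of_lt ?_) hdeg.symm
      rw [hp_deg, hp_deg]
      refine Finset.sum_lt_sum (fun j _ => ?_) ⟨i, Finset.mem_univ _, h2⟩
      rcases lt_or_ge j i with hji | hji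
      · exact (h1 j hji).le
      · have : j = i := Fin.ext (by rw [Fin.le_def] at hji; omega)
        subst this; exact h2.le
    · rw [hv0 i hi hi'] at h2
      omega

lemma hp_minIdx {n : ℕ} {m : Mon n} {i : Fin n} (hi : m i ≠ 0) : minIdx m ≤ i :=
  Nat.sInf_le ⟨i.2, hi⟩

lemma hp_minIdx_mem {n : ℕ} {m : Mon n} {i : Fin n} (hi : m i ≠ 0) :
    ∃ t : Fin n, (t : ℕ) = minIdx m ∧ m t ≠ 0 := by
  obtain ⟨h, h'⟩ : minIdx m ∈ {j : ℕ | ∃ h : j < n, m ⟨j, h⟩ ≠ 0} :=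
    Nat.sInf_mem ⟨i, i.2, hi⟩
  exact ⟨⟨minIdx m, h⟩, rfl, h'⟩

lemma hp_sub {n : ℕ} {m : Mon n} {t : Fin n} (ht : m t ≠ 0) :
    m - Finsupp.single t 1 + Finsupp.single t 1 = m := by
  apply tsub_add_cancel_of_le
  intro j
  by_cases h : t = j
  · subst h; simp; omega
  · simp [Finsupp.single_apply, h]

/-- If `m ∈ G(I^k)`, `s ∈ set(m)` and `x_s·m/x_{min(m)} ≺ v^k`, then
`s > min(m̃)`, where `m̃` is the part of `m` supported in `x_{l+1}, …, x_n`. -/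
theorem stmt7 (n d l k : ℕ) (K : Type*) [Field K] (a : ℕ → ℕ)
    (hd : 2 ≤ d) (hl2 : 2 ≤ l) (hln : l ≤ n - 1)
    (hsum : ∑ j ∈ Finset.Ico l n, a j = d - 1) (hk : 1 ≤ k) :
    ∀ m ∈ minGens K ((lexIdeal n l d a K) ^ k),
      ∀ s ∈ setOfGen K ((lexIdeal n l d a K) ^ k) m,
        precLT l (m + sing n s - sing n (minIdx m)) (k • vVec n l d) →
          minIdx (highPart l m) < s := by
  intro m hm s hs hprec
  obtain ⟨hsn, hs⟩ := hs
  obtain ⟨hmd, hml⟩ := hp_min K hl2 hln k hm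
  obtain ⟨z, ⟨hz, hzm⟩, hle⟩ := (hp_mem K _ _).1 hs
  obtain ⟨hzd, hzl⟩ := hp_min K hl2 hln k hz
  obtain ⟨s, rfl⟩ : ∃ s' : Fin n, (s' : ℕ) = s := ⟨⟨s, hsn⟩, rfl⟩
  rw [hp_sing] at hle hprec
  -- the minimum of `m` lies in the low part
  obtain ⟨i, hil, hi⟩ : ∃ i : Fin n, (i : ℕ) < l ∧ m i ≠ 0 := by
    by_contra! hc
    have : deg (lowPart l m) = 0 := by
      rw [hp_low]
      exact Finset.sum_eq_zero fun j _ => by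
        split_ifs with h
        · exact hc j h
        · rfl
    omega
  obtain ⟨q, hq, hqm⟩ := hp_minIdx_mem hi
  have hql : (q : ℕ) < l := by have := hp_minIdx hi; omega
  rw [← hq, hp_sing] at hprec
  have hE : m + Finsupp.single s 1 - Finsupp.single q 1 + Finsupp.single q 1
      = m + Finsupp.single s 1 := hp_sub (by simp [hqm])
  have hE1 := congrArg deg hE
  have hE2 := congrArg (fun x => deg (lowPart l x)) hE
  simp only [hp_deg_add, hp_low_add, hp_deg_single, hp_low_single] at hE1 hE2
  have hlow := hp_prec hd hl2 hln k (by omega) hprec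
  rw [if_pos hql] at hE2
  have hsl : ¬ (s : ℕ) < l := by
    intro h; rw [if_pos h] at hE2; omega
  rw [if_neg hsl] at hE2
  -- the index `t` removed from `x_s m`
  obtain ⟨c, hc⟩ := exists_add_of_le hle
  have hc1 := congrArg deg hc
  have hc2 := congrArg (fun x => deg (lowPart l x)) hc
  simp only [hp_deg_add, hp_low_add, hp_deg_single, hp_low_single, if_neg hsl] at hc1 hc2
  have hcd : deg c = 1 := by omega
  have hcl : deg (lowPart l c) = 0 := by omega
  obtain ⟨r, hr1, hr2⟩ := hzm
  have hcc : ∀ j : Fin n, m j + (if s = j then 1 else 0) = z j + c j := by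
    intro j
    have := DFunLike.congr_fun hc j
    simpa [Finsupp.single_apply] using this
  have hrs : r = s := by
    by_contra hne
    have := hcc r
    rw [if_neg (fun h => hne h.symm)] at this
    omega
  subst hrs
  have hc0 : ∀ j, r ≤ j → c j = 0 := by
    intro j hj
    have := hcc j
    rcases hj.eq_or_lt with h | h
    · subst h; simp at this; omega
    · have := hr1 j h
      rw [if_neg h.ne] at *
      omega
  obtain ⟨t, ht⟩ : ∃ t, c t ≠ 0 := by
    by_contra! h
    rw [hp_deg] at hcd
    simp [h] at hcd
  have htr : t < r := by
    by_contra h; exact ht (hc0 t (not_lt.1 h))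
  have htl : l ≤ (t : ℕ) := by
    by_contra h
    have := hp_low_pos l c t (by omega)
    omega
  have hmt : m t ≠ 0 := by
    have := hcc t
    rw [if_neg htr.ne'] at this
    omega
  have : highPart l m t ≠ 0 := by
    simpa [highPart, Finsupp.filter_apply, htl] using hmt
  exact lt_of_le_of_lt (hp_minIdx this) htr
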